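/- Let Σ = {σ₁,…,σₙ} be a finite family of injective non-unital ring endomorphisms of a ring R, and let Δ = {δ₁,…,δₙ} be a family of maps where each δᵢ is a σᵢ-derivation of R. Then R is Σ-rigid if and only if R is reduced and (Σ,Δ)-compatible. -/

import Mathlib

/-- A non-unital ring endomorphism: an additive and multiplicative map
(not required to send `1` to `1`). -/
def IsNUEnd {R : Type*} [Ring R] (σ : R → R) : Prop :=
  (∀ a b : R, σ (a + b) = σ a + σ b) ∧ (∀ a b : R, σ (a * b) = σ a * σ b)

/-- For a family `σ : Fin n → R → R` and `α ∈ ℕⁿ`, the composition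
`σ₁^{α₁} ∘ ⋯ ∘ σₙ^{αₙ}`. -/
def famPow {R : Type*} {n : ℕ} (σ : Fin n → R → R) (α : Fin n → ℕ) : R → R :=
  (List.ofFn (fun i => (σ i)^[α i])).foldr (· ∘ ·) id

/-- `R` is `Σ`-semicommutative: `a * b = 0` implies `a * r * σ^α(b) = 0`
for every `r ∈ R` and every `α ≠ 0`. -/
def SigmaSemicomm {R : Type*} [Ring R] {n : ℕ} (σ : Fin n → R → R) : Prop :=
  ∀ a b : R, a * b = 0 → ∀ r : R, ∀ α : Fin n → ℕ, α ≠ 0 → a * r * famPow σ α b = 0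

/-- `R` is `σ`-semicommutative (single endomorphism). -/
def SingleSemicomm {R : Type*} [Ring R] (σ : R → R) : Prop :=
  ∀ a b : R, a * b = 0 → ∀ r : R, a * r * σ b = 0

/-- `R` is `Σ`-rigid: `a * σ^α(a) = 0` implies `a = 0`. -/
def SigmaRigid {R : Type*} [Ring R] {n : ℕ} (σ : Fin n → R → R) : Prop :=
  ∀ (a : R) (α : Fin n → ℕ), a * famPow σ α a = 0 → a = 0

/-- `δ` is a `σ`-derivation of `R`. -/
def IsSigmaDerivation {R : Type*} [Ring R] (σ δ : R → R) : Prop :=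
  (∀ a b : R, δ (a + b) = δ a + δ b) ∧
    (∀ a b : R, δ (a * b) = σ a * δ b + δ a * b)

/-- The left annihilator `l_R(S)` of a subset `S ⊆ R`. -/
def leftAnn {R : Type*} [Ring R] (S : Set R) : Set R :=
  {x : R | ∀ s ∈ S, x * s = 0}

/-- The right annihilator `r_R(S)` of a subset `S ⊆ R`. -/
def rightAnn {R : Type*} [Ring R] (S : Set R) : Set R :=
  {x : R | ∀ s ∈ S, s * x = 0}

/-- `R` is Baer (left annihilator version): the left annihilator of every
nonempty subset is of the form `Re` for an idempotent `e`. -/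
def IsBaerLeft (R : Type*) [Ring R] : Prop :=
  ∀ S : Set R, S.Nonempty →
    ∃ e : R, e * e = e ∧ leftAnn S = {x : R | ∃ r : R, x = r * e}

/-- `R` is Baer (right annihilator version): the right annihilator of every
nonempty subset is of the form `eR` for an idempotent `e`. -/
def IsBaerRight (R : Type*) [Ring R] : Prop :=
  ∀ S : Set R, S.Nonempty →
    ∃ e : R, e * e = e ∧ rightAnn S = {x : R | ∃ r : R, x = e * r}

/-- `R` is quasi-Baer: the right annihilator of every right ideal
(an additive subgroup closed under right multiplication) is of the form `eR`
for an idempotent `e`. -/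
def IsQuasiBaer (R : Type*) [Ring R] : Prop :=
  ∀ I : AddSubgroup R, (∀ a ∈ I, ∀ r : R, a * r ∈ I) →
    ∃ e : R, e * e = e ∧ rightAnn (I : Set R) = {x : R | ∃ r : R, x = e * r}

/-- `R` is `Σ`-compatible. -/
def SigmaCompatible {R : Type*} [Ring R] {n : ℕ} (σ : Fin n → R → R) : Prop :=
  ∀ (a b : R) (α : Fin n → ℕ), a * b = 0 ↔ a * famPow σ α b = 0

/-- `R` is `Δ`-compatible. -/
def DeltaCompatible {R : Type*} [Ring R] {n : ℕ} (δ : Fin n → R → R) : Prop :=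
  ∀ (a b : R) (β : Fin n → ℕ), a * b = 0 → a * famPow δ β b = 0

theorem famPow_succ {R : Type*} {n : ℕ} (f : Fin (n + 1) → R → R) (α : Fin (n + 1) → ℕ) :
    famPow f α = (f 0)^[α 0] ∘ famPow (fun i => f i.succ) (fun i => α i.succ) := by
  simp [famPow, List.ofFn_succ]

theorem famPow_zero {R : Type*} {n : ℕ} (f : Fin n → R → R) : famPow f 0 = id := by
  induction n with
  | zero => rfl
  | succ n ih =>
    rw [famPow_succ]
    exact ih _

theorem famPow_single {R : Type*} {n : ℕ} (f : Fin n → R → R) (i : Fin n) :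
    famPow f (Pi.single i 1) = f i := by
  induction n with
  | zero => exact i.elim0
  | succ n ih =>
    rw [famPow_succ]
    cases i using Fin.cases with
    | zero =>
      have h : (fun j : Fin n => (Pi.single 0 1 : Fin (n + 1) → ℕ) j.succ) = 0 := by
        ext j
        simp
      rw [h, famPow_zero]
      simp
    | succ i =>
      have h : (fun j : Fin n => (Pi.single i.succ 1 : Fin (n + 1) → ℕ) j.succ) =
          Pi.single i 1 := by
        ext j
        simp [Pi.single_apply]
      rw [h, ih]
      simp [(Fin.succ_ne_zero i).symm]

/-- A property of self-maps that holds for the identity and each member of a family, and is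
stable under composition, holds for every `famPow` of the family. -/
theorem famPow_induction {R : Type*} {n : ℕ} {P : (R → R) → Prop} (f : Fin n → R → R)
    (α : Fin n → ℕ) (id_mem : P id) (comp_mem : ∀ g h, P g → P h → P (g ∘ h))
    (mem : ∀ i, P (f i)) : P (famPow f α) := by
  have iterate_mem (g : R → R) (hg : P g) (k : ℕ) : P g^[k] := by
    induction k with
    | zero => exact id_mem
    | succ k ih => exact comp_mem _ _ ih hg
  induction n with
  | zero => exact id_mem
  | succ n ih =>
    rw [famPow_succ]
    exact comp_mem _ _ (iterate_mem _ (mem 0) _) (ih _ _ fun i => mem i.succ)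

theorem famPow_mul {R : Type*} [Ring R] {n : ℕ} {σ : Fin n → R → R} (hσ : ∀ i, IsNUEnd (σ i))
    (α : Fin n → ℕ) (a b : R) : famPow σ α (a * b) = famPow σ α a * famPow σ α b :=
  famPow_induction (P := fun g => ∀ a b, g (a * b) = g a * g b) σ α (fun _ _ => rfl)
    (fun g h hg hh a b => by simp [hg, hh]) (fun i => (hσ i).2) a b

theorem famPow_map_zero {R : Type*} [Ring R] {n : ℕ} {σ : Fin n → R → R}
    (hσ : ∀ i, IsNUEnd (σ i)) (α : Fin n → ℕ) : famPow σ α 0 = 0 :=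
  famPow_induction (P := fun g => g 0 = 0) σ α rfl
    (fun g h hg hh => by simp [hg, hh]) fun i => by simpa using (hσ i).1 0 0

theorem mul_eq_zero_swap {R : Type*} [Ring R] [IsReduced R] {a b : R} (h : a * b = 0) :
    b * a = 0 :=
  IsReduced.eq_zero _ ⟨2, by rw [pow_two, mul_assoc, ← mul_assoc a, h, zero_mul, mul_zero]⟩

theorem SigmaRigid.isReduced {R : Type*} [Ring R] {n : ℕ} {σ : Fin n → R → R}
    (h : SigmaRigid σ) : IsReduced R :=
  (isReduced_iff_pow_one_lt 2 one_lt_two).2 fun a ha =>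
    h a 0 (by rw [famPow_zero, id, ← pow_two, ha])

theorem SigmaRigid.sigmaCompatible {R : Type*} [Ring R] {n : ℕ} {σ : Fin n → R → R}
    (hσ : ∀ i, IsNUEnd (σ i)) (h : SigmaRigid σ) : SigmaCompatible σ := by
  have := h.isReduced
  refine fun a b α => ⟨fun hab => h _ α ?_, fun hab => mul_eq_zero_swap (h _ α ?_)⟩
  · rw [famPow_mul hσ, mul_assoc, ← mul_assoc (famPow σ α b), ← famPow_mul hσ,
      mul_eq_zero_swap hab, famPow_map_zero hσ, zero_mul, mul_zero]
  · rw [famPow_mul hσ, mul_assoc, ← mul_assoc a, hab, zero_mul, mul_zero]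

theorem SigmaCompatible.mul_eq_zero_iff {R : Type*} [Ring R] {n : ℕ} {σ : Fin n → R → R}
    (h : SigmaCompatible σ) (i : Fin n) {a b : R} : a * σ i b = 0 ↔ a * b = 0 := by
  rw [h a b (Pi.single i 1), famPow_single]

theorem SigmaCompatible.deltaCompatible {R : Type*} [Ring R] [IsReduced R] {n : ℕ}
    {σ δ : Fin n → R → R} (h : SigmaCompatible σ) (hδ : ∀ i, IsSigmaDerivation (σ i) (δ i)) :
    DeltaCompatible δ := by
  intro a b β
  refine famPow_induction (P := fun g => ∀ b, a * b = 0 → a * g b = 0) δ β (fun _ => id)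
    (fun g k hg hk b hb => hg _ (hk b hb)) (fun i b hab => ?_) b
  have hsum : σ i a * δ i b + δ i a * b = 0 := by
    rw [← (hδ i).2, hab]
    simpa using (hδ i).1 0 0
  have hbσ : b * σ i a = 0 := (h.mul_eq_zero_iff i).2 (mul_eq_zero_swap hab)
  have hbδ : b * (δ i a * b) = 0 := by
    simpa [mul_add, ← mul_assoc, hbσ] using congrArg (b * ·) hsum
  have hδb : δ i a * b = 0 :=
    IsReduced.eq_zero _ ⟨2, by rw [pow_two, mul_assoc, hbδ, mul_zero]⟩
  rw [hδb, add_zero] at hsum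
  exact mul_eq_zero_swap ((h.mul_eq_zero_iff i).1 (mul_eq_zero_swap hsum))

/-- `R` is `Σ`-rigid iff `R` is reduced and
`(Σ,Δ)`-compatible. -/
theorem sigma_rigid_iff_reduced_compatible {R : Type*} [Ring R] {n : ℕ}
    (σ : Fin n → R → R) (δ : Fin n → R → R)
    (hσ : ∀ i, IsNUEnd (σ i)) (hinj : ∀ i, Function.Injective (σ i))
    (hδ : ∀ i, IsSigmaDerivation (σ i) (δ i)) :
    SigmaRigid σ ↔ (IsReduced R ∧ SigmaCompatible σ ∧ DeltaCompatible δ) := by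
  refine ⟨fun h => ?_, fun ⟨_, h, _⟩ a α ha => ?_⟩
  · have := h.isReduced
    exact ⟨this, h.sigmaCompatible hσ, (h.sigmaCompatible hσ).deltaCompatible hδ⟩
  · exact IsReduced.eq_zero a ⟨2, by rw [pow_two, h a a α, ha]⟩
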